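/- Let M be a real symmetric 3×3 matrix, ω ∈ ℝ³, and let X : ℝ → ℝ^{3×3} be a matrix-valued function such that X has derivative X(t₀)·ω^∧ at t₀ (i.e., the attitude kinematics Ẋ = X ω^∧ holds at t₀). Then the function t ↦ tr(M(I − X(t))) has derivative 2⟨ψ(M·X(t₀)), ω⟩ at t₀, where ψ(A) := ((A − Aᵀ)/2)^∨ ∈ ℝ³. -/

import Mathlib

open Matrix Real

noncomputable section

/-- The hat map: u^∧ y = u × y. -/
def hat (u : Fin 3 → ℝ) : Matrix (Fin 3) (Fin 3) ℝ :=
  !![0, -u 2, u 1; u 2, 0, -u 0; -u 1, u 0, 0]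

/-- ψ(A) = ((A − Aᵀ)/2)^∨, the vector of the antisymmetric projection. -/
def psiVec (A : Matrix (Fin 3) (Fin 3) ℝ) : Fin 3 → ℝ :=
  ![(A 2 1 - A 1 2) / 2, (A 0 2 - A 2 0) / 2, (A 1 0 - A 0 1) / 2]

/-- `tr(A ω^∧) = -2⟨ψ(A), ω⟩`. -/
theorem trace_mul_hat (A : Matrix (Fin 3) (Fin 3) ℝ) (ω : Fin 3 → ℝ) :
    (A * hat ω).trace = -(2 * (psiVec A ⬝ᵥ ω)) := by
  simp [Matrix.trace, Matrix.mul_apply, dotProduct, Fin.sum_univ_three, hat, psiVec]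
  ring

/-- The derivative of `t ↦ tr(M(I − X(t)))` for an entrywise differentiable `X`. -/
theorem hasDerivAt_trace_mul_one_sub {n : Type*} [Fintype n] [DecidableEq n]
    (M : Matrix n n ℝ) {X : ℝ → Matrix n n ℝ} {X' : Matrix n n ℝ} {t₀ : ℝ}
    (hX : ∀ i j, HasDerivAt (fun t => X t i j) (X' i j) t₀) :
    HasDerivAt (fun t => (M * (1 - X t)).trace) (-(M * X').trace) t₀ := by
  have h : HasDerivAt (fun t => ∑ i, ∑ j, M i j * ((1 : Matrix n n ℝ) j i - X t j i))
      (∑ i, ∑ j, M i j * -X' j i) t₀ :=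
    HasDerivAt.fun_sum fun i _ => HasDerivAt.fun_sum fun j _ =>
      ((hX j i).const_sub _).const_mul _
  simpa [Matrix.trace, Matrix.mul_apply] using h

/-- Along the attitude kinematics Ẋ = X ω^∧, the modified trace function
t ↦ tr(M(I − X(t))) has derivative 2⟨ψ(M X(t₀)), ω⟩ at t₀. -/
theorem modified_trace_derivative_along_kinematics
    (M : Matrix (Fin 3) (Fin 3) ℝ) (hM : M.IsSymm) (ω : Fin 3 → ℝ)
    (X : ℝ → Matrix (Fin 3) (Fin 3) ℝ) (t₀ : ℝ)
    (hX : ∀ i j, HasDerivAt (fun t => X t i j) ((X t₀ * hat ω) i j) t₀) :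
    HasDerivAt (fun t => (M * (1 - X t)).trace)
      (2 * (psiVec (M * X t₀) ⬝ᵥ ω)) t₀ := by
  have h := hasDerivAt_trace_mul_one_sub M hX
  rwa [← Matrix.mul_assoc, trace_mul_hat, neg_neg] at h

end
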